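/- arXiv:0810.0599 — 6 statements merged into one kernel-verified Lean document; each statement's English description precedes it below -/
import Mathlib

section
/- Let μ₁, μ₂ ∈ ℝ and σ₁², σ₂² ∈ (0,∞) be such that γ₁ := ⌊μ₁ − σ₁²⌋ ≤ γ₂ := ⌊μ₂ − σ₂²⌋. Then the total variation distance between the two translated Poisson distributions satisfies ‖TP(μ₁,σ₁²) − TP(μ₂,σ₂²)‖ ≤ 2{σ₁⁻¹|μ₁ − μ₂| + σ₁⁻²(|σ₁² − σ₂²| + 1)}. -/
open MeasureTheory ProbabilityTheory

/-- The translated Poisson distribution `TP(μ, σ²)` on `ℤ`: the law of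
`⌊μ - σ²⌋ + N` where `N ∼ Poisson(σ² + δ)` and `δ := μ - σ² - ⌊μ - σ²⌋`. -/
noncomputable def translatedPoisson (μ σ2 : ℝ) : PMF ℤ :=
  (poissonPMF (σ2 + Int.fract (μ - σ2)).toNNReal).map
    (fun n : ℕ => ⌊μ - σ2⌋ + (n : ℤ))

/-- The total variation norm `‖Q - Q'‖ = ∑_{i ∈ ℤ} |Q(i) - Q'(i)|` of the difference of two
probability distributions on `ℤ`. -/
noncomputable def tvNorm (p q : PMF ℤ) : ℝ := ∑' i : ℤ, |(p i).toReal - (q i).toReal|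

/-- The Poisson probability `exp (-a) * a ^ n / n!`, with a real parameter `a`. -/
noncomputable def poissonWeight (a : ℝ) (n : ℕ) : ℝ :=
  Real.exp (-a) * a ^ n / (n.factorial : ℝ)

lemma poissonWeight_pos {a : ℝ} (ha : 0 < a) (n : ℕ) : 0 < poissonWeight a n := by
  unfold poissonWeight
  positivity

lemma hasSum_poissonWeight {a : ℝ} (ha : 0 < a) : HasSum (poissonWeight a) 1 := by
  have h := ProbabilityTheory.hasSum_one_poissonMeasure a.toNNReal
  rw [Real.coe_toNNReal a ha.le] at h
  exact h

lemma succ_mul_poissonWeight_succ (a : ℝ) (n : ℕ) :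
    ((n : ℝ) + 1) * poissonWeight a (n + 1) = a * poissonWeight a n := by
  unfold poissonWeight
  rw [Nat.factorial_succ]
  push_cast
  have : (n.factorial : ℝ) ≠ 0 := by positivity
  field_simp
  ring

lemma summable_poissonWeight_mul {a C : ℝ} (ha : 0 < a) {h : ℕ → ℝ} (hC : ∀ n, |h n| ≤ C) :
    Summable fun n ↦ poissonWeight a n * h n := by
  refine Summable.of_norm_bounded ((hasSum_poissonWeight ha).summable.mul_right C) fun n ↦ ?_
  rw [norm_mul, Real.norm_of_nonneg (poissonWeight_pos ha n).le, Real.norm_eq_abs]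
  exact mul_le_mul_of_nonneg_left (hC n) (poissonWeight_pos ha n).le

/-- The Stein identity for the Poisson distribution. -/
lemma hasSum_poissonWeight_mul_natCast_mul {a C : ℝ} (ha : 0 < a) {h : ℕ → ℝ}
    (hC : ∀ n, |h n| ≤ C) :
    HasSum (fun n ↦ poissonWeight a n * (n * h n))
      (a * ∑' n, poissonWeight a n * h (n + 1)) := by
  rw [← hasSum_nat_add_iff' 1]
  have hs : Summable fun n ↦ poissonWeight a n * h (n + 1) :=
    summable_poissonWeight_mul ha fun n ↦ hC (n + 1)
  convert! hs.hasSum.mul_left a using 1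
  · ext n
    have := succ_mul_poissonWeight_succ a n
    push_cast
    linear_combination h (n + 1) * this
  · simp

/-- The lower tail `∑_{j < n} Po(a){j}`. -/
noncomputable def poissonLower (a : ℝ) (n : ℕ) : ℝ := ∑ j ∈ Finset.range n, poissonWeight a j

/-- The upper tail `∑_{j ≥ n} Po(a){j}`. -/
noncomputable def poissonUpper (a : ℝ) (n : ℕ) : ℝ := ∑' j : ℕ, poissonWeight a (j + n)

lemma poissonLower_succ (a : ℝ) (n : ℕ) :
    poissonLower a (n + 1) = poissonLower a n + poissonWeight a n :=
  Finset.sum_range_succ _ _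

lemma poissonLower_nonneg {a : ℝ} (ha : 0 < a) (n : ℕ) : 0 ≤ poissonLower a n :=
  Finset.sum_nonneg fun j _ ↦ (poissonWeight_pos ha j).le

lemma poissonUpper_nonneg {a : ℝ} (ha : 0 < a) (n : ℕ) : 0 ≤ poissonUpper a n :=
  tsum_nonneg fun j ↦ (poissonWeight_pos ha (j + n)).le

lemma poissonLower_add_poissonUpper {a : ℝ} (ha : 0 < a) (n : ℕ) :
    poissonLower a n + poissonUpper a n = 1 := by
  rw [poissonLower, poissonUpper, (hasSum_poissonWeight ha).summable.sum_add_tsum_nat_add,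
    (hasSum_poissonWeight ha).tsum_eq]

lemma summable_poissonWeight_nat_add {a : ℝ} (ha : 0 < a) (n : ℕ) :
    Summable fun j ↦ poissonWeight a (j + n) :=
  (summable_nat_add_iff n).2 (hasSum_poissonWeight ha).summable

lemma natCast_mul_poissonUpper_succ_le {a : ℝ} (ha : 0 < a) (n : ℕ) :
    n * poissonUpper a (n + 1) ≤ a * poissonUpper a n := by
  rw [poissonUpper, poissonUpper, ← tsum_mul_left, ← tsum_mul_left]
  refine ((summable_poissonWeight_nat_add ha (n + 1)).mul_left _).tsum_le_tsum (fun j ↦ ?_)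
    ((summable_poissonWeight_nat_add ha n).mul_left _)
  rw [← succ_mul_poissonWeight_succ, ← add_assoc]
  refine mul_le_mul_of_nonneg_right ?_ (poissonWeight_pos ha _).le
  push_cast
  linarith [(Nat.cast_nonneg j : (0 : ℝ) ≤ j)]

lemma mul_poissonLower_le {a : ℝ} (ha : 0 < a) (n : ℕ) :
    a * poissonLower a n ≤ n * poissonLower a (n + 1) := by
  induction n with
  | zero => simp [poissonLower]
  | succ n ih =>
    rw [poissonLower_succ a (n + 1), poissonLower_succ a n] at *
    have h1 := succ_mul_poissonWeight_succ a n
    have h2 := poissonLower_nonneg ha n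
    have h3 := poissonWeight_pos ha n
    push_cast
    nlinarith

lemma mul_poissonLower_le_two_mul {a s : ℝ} (ha : 0 < a) (hs : s ^ 2 = a) (n : ℕ) :
    (a + s - 1 / 2 - n) * poissonLower a (n + 1) ≤ 2 * a * poissonWeight a n := by
  induction n with
  | zero =>
    have h := poissonWeight_pos ha 0
    simp only [poissonLower, zero_add, Finset.sum_range_one]
    refine mul_le_mul_of_nonneg_right ?_ h.le
    push_cast
    nlinarith [sq_nonneg (s - 1 / 2)]
  | succ n ih =>
    have hp := poissonWeight_pos ha (n + 1)
    rcases le_or_gt (a + s - 1 / 2 - (n + 1 : ℕ)) 0 with hq | hq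
    · exact (mul_nonpos_of_nonpos_of_nonneg hq (poissonLower_nonneg ha _)).trans (by positivity)
    push_cast at hq ⊢
    have h1 := succ_mul_poissonWeight_succ a n
    rw [poissonLower_succ a (n + 1)]
    obtain ⟨q, hqd⟩ : ∃ q, q = a + s - 1 / 2 - ((n : ℝ) + 1) := ⟨_, rfl⟩
    rw [← hqd] at hq ⊢
    rw [show a + s - 1 / 2 - (n : ℝ) = q + 1 by linarith, mul_assoc, ← h1] at ih
    have hn : (n : ℝ) + 1 = a + s - 1 / 2 - q := by linarith
    rw [hn] at ih
    refine le_of_mul_le_mul_left ?_ (by linarith : 0 < q + 1)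
    have h2 := mul_le_mul_of_nonneg_left ih hq.le
    have h3 : 0 ≤ poissonWeight a (n + 1) *
        (2 * a * (q + 1) - q * (q + 1) - 2 * q * (a + s - 1 / 2 - q)) := by
      refine mul_nonneg hp.le ?_
      nlinarith [sq_nonneg (s - q)]
    nlinarith

lemma mul_poissonUpper_le_two_mul {a s : ℝ} (ha : 0 < a) (hs : s ^ 2 = a) (n : ℕ) :
    (n - a + s + 1 / 2) * poissonUpper a (n + 1) ≤ 2 * a * poissonWeight a n := by
  have hp := poissonWeight_pos ha n
  rcases le_or_gt (n - a + s + 1 / 2) 0 with hq | hq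
  · exact (mul_nonpos_of_nonpos_of_nonneg hq (poissonUpper_nonneg ha _)).trans (by positivity)
  have key (m : ℕ) : ∑ j ∈ Finset.range m, poissonWeight a (j + (n + 1)) ≤
      2 * a * poissonWeight a n / (n - a + s + 1 / 2) -
        2 * a * poissonWeight a (n + m) / (n - a + s + 1 / 2 + m) := by
    induction m with
    | zero => simp
    | succ m ih =>
      rw [Finset.sum_range_succ]
      have hp' := poissonWeight_pos ha (n + m + 1)
      have h1 := succ_mul_poissonWeight_succ a (n + m)
      have hm : (0 : ℝ) ≤ m := m.cast_nonneg
      obtain ⟨q, hqd⟩ : ∃ q, q = n - a + s + 1 / 2 + (m : ℝ) := ⟨_, rfl⟩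
      have hq0 : 0 < q := by linarith
      rw [← hqd] at ih
      rw [show m + (n + 1) = n + m + 1 by ring, ← add_assoc n m 1]
      push_cast at h1 ⊢
      rw [← add_assoc, ← hqd]
      rw [mul_assoc 2 a (poissonWeight a (n + m)), ← h1] at ih
      suffices poissonWeight a (n + m + 1) + 2 * a * poissonWeight a (n + m + 1) / (q + 1) ≤
          2 * ((n + m + 1) * poissonWeight a (n + m + 1)) / q by linarith
      have hnm : (n : ℝ) + m + 1 = q + a - s + 1 / 2 := by linarith
      rw [hnm, le_div_iff₀ hq0, ← sub_nonneg]
      have : 2 * ((q + a - s + 1 / 2) * poissonWeight a (n + m + 1)) -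
          (poissonWeight a (n + m + 1) + 2 * a * poissonWeight a (n + m + 1) / (q + 1)) * q =
          poissonWeight a (n + m + 1) *
            (2 * (q + a - s + 1 / 2) * (q + 1) - (q + 1) * q - 2 * a * q) / (q + 1) := by
        field_simp
        ring
      rw [this]
      refine div_nonneg (mul_nonneg hp'.le ?_) (by linarith)
      nlinarith [sq_nonneg (q + 1 - s)]
  have h := (summable_poissonWeight_nat_add ha (n + 1)).tsum_le_of_sum_range_le
    (c := 2 * a * poissonWeight a n / (n - a + s + 1 / 2)) fun m ↦ by
      refine (key m).trans (sub_le_self _ ?_)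
      have := poissonWeight_pos ha (n + m)
      positivity
  rw [le_div_iff₀ hq] at h
  rw [mul_comm]
  exact h

lemma poissonLower_mul_poissonUpper_le {a : ℝ} (ha : 0 < a) (n : ℕ) :
    poissonLower a (n + 1) * poissonUpper a (n + 1) ≤ √a * poissonWeight a n := by
  have hs := Real.sq_sqrt ha.le
  have hs0 := Real.sqrt_pos.2 ha
  have h1 := mul_le_mul_of_nonneg_right (mul_poissonLower_le_two_mul ha hs n)
    (poissonUpper_nonneg ha (n + 1))
  have h2 := mul_le_mul_of_nonneg_right (mul_poissonUpper_le_two_mul ha hs n)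
    (poissonLower_nonneg ha (n + 1))
  have h3 := poissonLower_add_poissonUpper ha (n + 1)
  have h4 : √a * (poissonLower a (n + 1) * poissonUpper a (n + 1)) ≤ a * poissonWeight a n := by
    linear_combination h1 / 2 + h2 / 2 + a * poissonWeight a n * h3
  refine le_of_mul_le_mul_left (h4.trans_eq ?_) hs0
  linear_combination -poissonWeight a n * hs

lemma sum_range_mul_le_poissonLower {a : ℝ} (ha : 0 < a) {f : ℕ → ℝ} (hf : ∀ n, f n ∈ Set.Icc 0 1)
    (n : ℕ) : ∑ j ∈ Finset.range n, poissonWeight a j * f j ∈ Set.Icc 0 (poissonLower a n) :=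
  ⟨Finset.sum_nonneg fun j _ ↦ mul_nonneg (poissonWeight_pos ha j).le (hf j).1,
    Finset.sum_le_sum fun j _ ↦ mul_le_of_le_one_right (poissonWeight_pos ha j).le (hf j).2⟩

lemma tsum_mul_le_poissonUpper {a : ℝ} (ha : 0 < a) {f : ℕ → ℝ} (hf : ∀ n, f n ∈ Set.Icc 0 1)
    (n : ℕ) : ∑' j, poissonWeight a (j + n) * f (j + n) ∈ Set.Icc 0 (poissonUpper a n) := by
  have hsum : Summable fun j ↦ poissonWeight a j * f j :=
    summable_poissonWeight_mul ha (C := 1) fun n ↦ by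
      rw [abs_of_nonneg (hf n).1]; exact (hf n).2
  exact ⟨tsum_nonneg fun j ↦ mul_nonneg (poissonWeight_pos ha _).le (hf _).1,
    ((summable_nat_add_iff n).2 hsum).tsum_le_tsum
      (fun j ↦ mul_le_of_le_one_right (poissonWeight_pos ha _).le (hf _).2)
      (summable_poissonWeight_nat_add ha n)⟩

/-- Solution of the Poisson Stein equation for a `[0, 1]`-valued function, with the classical
bounds on the solution and on its increments. -/
lemma exists_poisson_stein_solution {a : ℝ} (ha : 0 < a) {f : ℕ → ℝ}
    (hf : ∀ n, f n ∈ Set.Icc 0 1) :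
    ∃ g : ℕ → ℝ, (∀ n : ℕ, a * g (n + 1) - n * g n = f n - ∑' j, poissonWeight a j * f j) ∧
      (∀ n, |g n| ≤ (√a)⁻¹) ∧ ∀ n, |g (n + 1) - g n| ≤ a⁻¹ := by
  have hsum : Summable fun j ↦ poissonWeight a j * f j :=
    summable_poissonWeight_mul ha (C := 1) fun n ↦ by
      rw [abs_of_nonneg (hf n).1]; exact (hf n).2
  set m := ∑' j, poissonWeight a j * f j with hm
  let H (n : ℕ) : ℝ := ∑ j ∈ Finset.range n, poissonWeight a j * f j
  let G (n : ℕ) : ℝ := ∑' j, poissonWeight a (j + n) * f (j + n)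
  have hH (n) : H n ∈ Set.Icc 0 (poissonLower a n) := sum_range_mul_le_poissonLower ha hf n
  have hG (n) : G n ∈ Set.Icc 0 (poissonUpper a n) := tsum_mul_le_poissonUpper ha hf n
  have hHG (n) : H n + G n = m := hsum.sum_add_tsum_nat_add n
  have hHs (n) : H (n + 1) = H n + poissonWeight a n * f n := Finset.sum_range_succ _ _
  have hFT (n) := poissonLower_add_poissonUpper ha n
  have hF (n) := poissonLower_nonneg ha n
  have hT (n) := poissonUpper_nonneg ha n
  have hp (n) := poissonWeight_pos ha n
  let S (n : ℕ) : ℝ := H n - poissonLower a n * m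
  have hS (n) : S n = H n * poissonUpper a n - poissonLower a n * G n := by
    simp only [S]
    linear_combination poissonLower a n * hHG n - H n * hFT n
  have hSs (n) : S (n + 1) = S n + poissonWeight a n * (f n - m) := by
    simp only [S, hHs, poissonLower_succ]
    ring
  have hS0 : S 0 = 0 := by simp [S, H, poissonLower]
  clear_value S
  let g (n : ℕ) : ℝ := S (n - 1 + 1) / (a * poissonWeight a (n - 1))
  have hgs (n) : g (n + 1) = S (n + 1) / (a * poissonWeight a n) := rfl
  have hg0 : g 0 = g 1 := rfl
  have hgn (n : ℕ) : n * g n * poissonWeight a n = S n := by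
    cases n with
    | zero => simp [hS0]
    | succ n =>
      have h1 := succ_mul_poissonWeight_succ a n
      have h2 := mul_pos ha (hp n)
      rw [hgs, mul_div_assoc', div_mul_eq_mul_div, div_eq_iff h2.ne']
      push_cast
      linear_combination S (n + 1) * h1
  have hgs' (n) : a * g (n + 1) * poissonWeight a n = S (n + 1) := by
    have h2 := hp n
    rw [hgs]
    field_simp
  have hgb (n) : |g (n + 1)| ≤ (√a)⁻¹ := by
    have hs0 := Real.sqrt_pos.2 ha
    have hs := Real.mul_self_sqrt ha.le
    have hap := mul_pos ha (hp n)
    have h1 : |S (n + 1)| ≤ √a * poissonWeight a n := by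
      refine le_trans ?_ (poissonLower_mul_poissonUpper_le ha n)
      rw [hS, abs_le]
      have := mul_le_mul_of_nonneg_right (hH (n + 1)).2 (hT (n + 1))
      have := mul_le_mul_of_nonneg_left (hG (n + 1)).2 (hF (n + 1))
      have := mul_nonneg (hH (n + 1)).1 (hT (n + 1))
      have := mul_nonneg (hF (n + 1)) (hG (n + 1)).1
      constructor <;> linarith
    rw [hgs, abs_div, abs_of_pos hap, div_le_iff₀ hap]
    refine h1.trans_eq ?_
    rw [eq_inv_mul_iff_mul_eq₀ hs0.ne']
    linear_combination poissonWeight a n * hs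
  refine ⟨g, fun n ↦ ?_, fun n ↦ ?_, fun n ↦ ?_⟩
  · refine mul_right_cancel₀ (hp n).ne' ?_
    linear_combination hgs' n - hgn n + hSs n
  · cases n with
    | zero => exact hgb 0
    | succ n => exact hgb n
  · rcases Nat.eq_zero_or_pos n with rfl | hn
    · simpa [hg0] using ha.le
    have hn' : (0 : ℝ) < n := by exact_mod_cast hn
    have h1 : (g (n + 1) - g n) * (a * n * poissonWeight a n) = n * S (n + 1) - a * S n := by
      linear_combination n * hgs' n - a * hgn n
    have hpos : 0 < a * n * poissonWeight a n := mul_pos (mul_pos ha hn') (hp n)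
    have hU := natCast_mul_poissonUpper_succ_le ha n
    have hL := mul_poissonLower_le ha n
    have hLs := poissonLower_succ a n
    have e : n * S (n + 1) - a * S n =
        H n * (n * poissonUpper a (n + 1) - a * poissonUpper a n) +
        poissonWeight a n * f n * (n * poissonUpper a (n + 1) + a * poissonLower a n) +
        G (n + 1) * (a * poissonLower a n - n * poissonLower a (n + 1)) := by
      have e2 : G n = G (n + 1) + poissonWeight a n * f n := by
        linear_combination hHG n - hHG (n + 1) + hHs n
      rw [hS, hS, e2, hHs]
      ring
    have hpf := mul_nonneg (hp n).le (hf n).1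
    have hpf' := mul_le_of_le_one_right (hp n).le (hf n).2
    have hsum1 := hFT (n + 1)
    have hsum0 := hFT n
    have hk : 0 ≤ n * poissonUpper a (n + 1) + a * poissonLower a n :=
      add_nonneg (mul_nonneg hn'.le (hT _)) (mul_nonneg ha.le (hF _))
    have hk' : n * poissonUpper a (n + 1) + a * poissonLower a n ≤ n := by
      linear_combination hL + n * hsum1
    have u1 := mul_nonneg (hH n).1 (sub_nonneg.2 hU)
    have u2 := mul_nonneg (hG (n + 1)).1 (sub_nonneg.2 hL)
    have u1' := mul_le_mul_of_nonneg_right (hH n).2 (sub_nonneg.2 hU)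
    have u2' := mul_le_mul_of_nonneg_right (hG (n + 1)).2 (sub_nonneg.2 hL)
    have u3 := mul_le_mul_of_nonneg_right hpf' hk
    have u3' := mul_nonneg hpf hk
    have u4 := mul_le_mul_of_nonneg_left hk' (hp n).le
    have hTs : poissonUpper a n = poissonUpper a (n + 1) + poissonWeight a n := by linarith
    have h2 : |n * S (n + 1) - a * S n| ≤ n * poissonWeight a n := by
      rw [e, abs_le]
      constructor
      · linear_combination u1' + u2' + u3' + u4 + a * poissonLower a n * hTs +
          n * poissonUpper a (n + 1) * hLs
      · linarith
    rw [← h1, abs_mul, abs_of_pos hpos] at h2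
    rw [← one_div, le_div_iff₀ ha]
    have hnp := mul_pos hn' (hp n)
    refine le_of_mul_le_mul_right ?_ hnp
    linarith

lemma abs_tsum_poissonWeight_shift_sub_le {a b : ℝ} (ha : 0 < a) (hb : 0 < b) (k : ℕ)
    {f : ℕ → ℝ} (hf : ∀ n, f n ∈ Set.Icc 0 1) :
    |∑' n, poissonWeight b n * f (n + k) - ∑' n, poissonWeight a n * f n| ≤
      (√a)⁻¹ * |a - b - k| + a⁻¹ * |a - b| := by
  obtain ⟨g, hg, hgb, hgd⟩ := exists_poisson_stein_solution ha hf
  set m := ∑' n, poissonWeight a n * f n with hm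
  have hfb (n) : |f n| ≤ 1 := by rw [abs_of_nonneg (hf n).1]; exact (hf n).2
  have s1 := hasSum_poissonWeight_mul_natCast_mul hb (h := fun n ↦ g (n + k)) (C := (√a)⁻¹)
    fun n ↦ hgb _
  have s2 : Summable fun n ↦ poissonWeight b n * g (n + 1 + k) :=
    summable_poissonWeight_mul hb fun n ↦ hgb _
  have s3 : Summable fun n ↦ poissonWeight b n * f (n + k) :=
    summable_poissonWeight_mul hb fun n ↦ hfb _
  have t1 : HasSum (fun n ↦ poissonWeight b n *
        ((a - b) * (g (n + 1 + k) - g (n + k)) + (a - b - k) * g (n + k)))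
      (∑' n, poissonWeight b n * f (n + k) - m) := by
    have h := (s3.hasSum.sub ((hasSum_poissonWeight hb).mul_right m)).add
      (s1.sub (s2.hasSum.mul_left b))
    convert! h using 1
    · ext n
      have := hg (n + k)
      rw [show n + k + 1 = n + 1 + k by ring] at this
      push_cast at this
      linear_combination poissonWeight b n * this
    · ring
  refine (t1.norm_le_of_bounded ((hasSum_poissonWeight hb).mul_right
    ((√a)⁻¹ * |a - b - k| + a⁻¹ * |a - b|)) fun n ↦ ?_).trans_eq (one_mul _)
  rw [norm_mul, Real.norm_of_nonneg (poissonWeight_pos hb n).le, Real.norm_eq_abs]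
  refine mul_le_mul_of_nonneg_left ((abs_add_le _ _).trans ?_) (poissonWeight_pos hb n).le
  rw [abs_mul, abs_mul, add_comm, mul_comm |a - b - k|, mul_comm |a - b|]
  have := hgd (n + k)
  rw [show n + k + 1 = n + 1 + k by ring] at this
  gcongr
  exact hgb _

lemma tsum_abs_poissonWeight_sub_shift_le {a b : ℝ} (ha : 0 < a) (hb : 0 < b) (k : ℕ) :
    ∑' n, |poissonWeight a n - if k ≤ n then poissonWeight b (n - k) else 0| ≤
      2 * ((√a)⁻¹ * |a - b - k| + a⁻¹ * |a - b|) := by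
  set q : ℕ → ℝ := fun n ↦ if k ≤ n then poissonWeight b (n - k) else 0 with hq
  let f (n : ℕ) : ℝ := if q n ≤ poissonWeight a n then 1 else 0
  have hf (n) : f n ∈ Set.Icc 0 1 := by
    simp only [f]
    split_ifs <;> simp
  have hfb (n) : |f n| ≤ 1 := by rw [abs_of_nonneg (hf n).1]; exact (hf n).2
  have shift {h : ℕ → ℝ} (hh : Summable fun n ↦ poissonWeight b n * h (n + k)) :
      HasSum (fun n ↦ q n * h n) (∑' n, poissonWeight b n * h (n + k)) := by
    rw [← hasSum_nat_add_iff' k, Finset.sum_eq_zero, sub_zero]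
    · simpa [hq] using hh.hasSum
    · intro j hj
      simp [hq, Finset.mem_range.1 hj]
  have e (n) : |poissonWeight a n - q n| =
      2 * (poissonWeight a n * f n - q n * f n) - (poissonWeight a n - q n) := by
    simp only [f]
    split_ifs with h
    · rw [abs_of_nonneg (by linarith)]; ring
    · rw [abs_of_nonpos (by linarith)]; ring
  have s1 := (summable_poissonWeight_mul ha hfb).hasSum
  have s2 := shift (summable_poissonWeight_mul hb fun n ↦ hfb (n + k))
  have s3 := hasSum_poissonWeight ha
  have s4 := shift (h := fun _ ↦ 1) (by simpa using (hasSum_poissonWeight hb).summable)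
  simp only [mul_one, (hasSum_poissonWeight hb).tsum_eq] at s4
  have s := ((s1.sub s2).mul_left 2).sub (s3.sub s4)
  have hle := abs_tsum_poissonWeight_shift_sub_le ha hb k hf
  rw [abs_sub_comm] at hle
  refine (tsum_congr e).trans_le ?_
  rw [s.tsum_eq, sub_self, sub_zero]
  exact mul_le_mul_of_nonneg_left ((le_abs_self _).trans hle) zero_le_two

set_option linter.deprecated false in
lemma translatedPoisson_apply_toReal {μ σ2 : ℝ} (h : 0 < σ2) (i : ℤ) :
    (translatedPoisson μ σ2 i).toReal =
      if ⌊μ - σ2⌋ ≤ i then poissonWeight (σ2 + Int.fract (μ - σ2)) (i - ⌊μ - σ2⌋).toNat else 0 := by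
  have hpos : 0 ≤ σ2 + Int.fract (μ - σ2) := add_nonneg h.le (Int.fract_nonneg _)
  rw [translatedPoisson, PMF.map_apply]
  split_ifs with hi
  · refine (congrArg ENNReal.toReal (tsum_eq_single (i - ⌊μ - σ2⌋).toNat fun n hn ↦ ?_)).trans ?_
    · exact if_neg fun hin ↦ hn (by omega)
    · rw [if_pos (by omega), ← poissonPMFReal_ofReal_eq_poissonPMF,
        ENNReal.toReal_ofReal poissonPMFReal_nonneg]
      simp only [poissonPMFReal, poissonWeight, Real.coe_toNNReal _ hpos]
  · refine (congrArg ENNReal.toReal (ENNReal.tsum_eq_zero.2 fun n ↦ ?_)).trans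
      ENNReal.toReal_zero
    exact if_neg (by omega)

/-- If `γ₁ := ⌊μ₁ - σ₁²⌋ ≤ γ₂ := ⌊μ₂ - σ₂²⌋`, then
`‖TP(μ₁,σ₁²) - TP(μ₂,σ₂²)‖ ≤ 2 {σ₁⁻¹ |μ₁ - μ₂| + σ₁⁻² (|σ₁² - σ₂²| + 1)}`. -/
theorem tvNorm_translatedPoisson_sub_translatedPoisson_le
    (μ1 μ2 σ1sq σ2sq : ℝ) (h1 : 0 < σ1sq) (h2 : 0 < σ2sq)
    (hγ : ⌊μ1 - σ1sq⌋ ≤ ⌊μ2 - σ2sq⌋) :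
    tvNorm (translatedPoisson μ1 σ1sq) (translatedPoisson μ2 σ2sq)
      ≤ 2 * ((Real.sqrt σ1sq)⁻¹ * |μ1 - μ2| + σ1sq⁻¹ * (|σ1sq - σ2sq| + 1)) := by
  have d1 := Int.fract_nonneg (μ1 - σ1sq)
  have d2 := Int.fract_nonneg (μ2 - σ2sq)
  have d1' := Int.fract_lt_one (μ1 - σ1sq)
  have d2' := Int.fract_lt_one (μ2 - σ2sq)
  have e1 := Int.floor_add_fract (μ1 - σ1sq)
  have e2 := Int.floor_add_fract (μ2 - σ2sq)
  simp only [tvNorm, translatedPoisson_apply_toReal h1, translatedPoisson_apply_toReal h2]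
  generalize ⌊μ1 - σ1sq⌋ = γ1, ⌊μ2 - σ2sq⌋ = γ2, Int.fract (μ1 - σ1sq) = δ1,
    Int.fract (μ2 - σ2sq) = δ2 at *
  obtain ⟨k, rfl⟩ := Int.le.dest hγ
  have hinj : Function.Injective fun n : ℕ ↦ γ1 + (n : ℤ) := fun m n hmn ↦ by
    simpa using hmn
  rw [← hinj.tsum_eq]
  · have hterm (n : ℕ) :
        |(if γ1 ≤ γ1 + (n : ℤ) then poissonWeight (σ1sq + δ1) (γ1 + n - γ1).toNat else 0) -
          if γ1 + (k : ℤ) ≤ γ1 + n then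
            poissonWeight (σ2sq + δ2) (γ1 + n - (γ1 + k)).toNat else 0| =
        |poissonWeight (σ1sq + δ1) n -
          if k ≤ n then poissonWeight (σ2sq + δ2) (n - k) else 0| := by
      rw [show (γ1 + n - γ1 : ℤ).toNat = n by omega,
        show (γ1 + n - (γ1 + k) : ℤ).toNat = n - k by omega]
      simp
    simp only [hterm]
    refine (tsum_abs_poissonWeight_sub_shift_le (by linarith) (by linarith) k).trans ?_
    push_cast at e2
    have hμ : σ1sq + δ1 - (σ2sq + δ2) - k = μ1 - μ2 := by linarith
    have hσ : |σ1sq + δ1 - (σ2sq + δ2)| ≤ |σ1sq - σ2sq| + 1 := by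
      rw [show σ1sq + δ1 - (σ2sq + δ2) = (σ1sq - σ2sq) + (δ1 - δ2) by ring]
      refine (abs_add_le _ _).trans (add_le_add_right ?_ _)
      rw [abs_le]
      constructor <;> linarith
    have hle : σ1sq ≤ σ1sq + δ1 := by linarith
    have hs := Real.sqrt_pos.2 h1
    rw [hμ]
    gcongr
  · intro i hi
    rw [Function.mem_support] at hi
    by_contra hni
    have hlt : i < γ1 := by
      by_contra! hge
      exact hni ⟨(i - γ1).toNat, by simp only; omega⟩
    refine hi ?_
    rw [if_neg (by omega), if_neg (by omega), sub_zero, abs_zero]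
end

section
/- An integer-valued random variable W with E|W| < ∞ has distribution TP(μ,σ²) if and only if E{λ' f(W+1) − (W − γ) f(W)} = 0 for every bounded function f : ℤ → ℝ, where γ := ⌊μ − σ²⌋ and λ' := σ² + (μ − σ² − γ). -/
open MeasureTheory ProbabilityTheory

/-- The Poisson recursion, shifted by `γ`: `l ν{j} = (j + 1 - γ) ν{j + 1}` for all integers `j`. -/
def ShiftedPoissonRecursion (ν : Measure ℤ) (l : ℝ) (γ : ℤ) : Prop :=
  ∀ j : ℤ, l * ν.real {j} = ((j : ℝ) + 1 - γ) * ν.real {j + 1}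

theorem integrable_mul_of_abs_le {ν : Measure ℤ} {g f : ℤ → ℝ} {C : ℝ} (hg : Integrable g ν)
    (hf : ∀ j, |f j| ≤ C) : Integrable (fun j => g j * f j) ν :=
  hg.mul_bdd (c := C) (Measurable.of_discrete.aestronglyMeasurable) (.of_forall hf)

theorem integral_stein_eq_zero {ν : Measure ℤ} [IsFiniteMeasure ν] {l : ℝ} {γ : ℤ}
    (hν : Integrable (fun j : ℤ => (j : ℝ)) ν) (h : ShiftedPoissonRecursion ν l γ)
    {f : ℤ → ℝ} {C : ℝ} (hf : ∀ j, |f j| ≤ C) :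
    ∫ j, (l * f (j + 1) - ((j : ℝ) - γ) * f j) ∂ν = 0 := by
  have h₁ : Integrable (fun j : ℤ => l * f (j + 1)) ν :=
    integrable_mul_of_abs_le (integrable_const l) fun j => hf (j + 1)
  have h₂ : Integrable (fun j : ℤ => ((j : ℝ) - γ) * f j) ν :=
    integrable_mul_of_abs_le (hν.sub (integrable_const _)) hf
  rw [integral_sub h₁ h₂, integral_countable h₁, integral_countable h₂,
    ← (Equiv.addRight (1 : ℤ)).tsum_eq (fun j : ℤ => ν.real {j} • (((j : ℝ) - γ) * f j)),
    sub_eq_zero]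
  refine tsum_congr fun j => ?_
  simp only [Equiv.coe_addRight, smul_eq_mul]
  push_cast
  linear_combination f (j + 1) * h j

theorem ShiftedPoissonRecursion.of_integral_eq_zero {ν : Measure ℤ} [IsFiniteMeasure ν] {l : ℝ}
    {γ : ℤ} (h : ∀ f : ℤ → ℝ, (∃ C : ℝ, ∀ j, |f j| ≤ C) →
      ∫ j, (l * f (j + 1) - ((j : ℝ) - γ) * f j) ∂ν = 0) :
    ShiftedPoissonRecursion ν l γ := by
  intro j
  have key := h (Set.indicator {j + 1} 1) ⟨1, fun k => by
    by_cases hk : k = j + 1 <;> simp [hk]⟩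
  have hfun : (fun k : ℤ => l * Set.indicator {j + 1} (1 : ℤ → ℝ) (k + 1)
      - ((k : ℝ) - γ) * Set.indicator {j + 1} (1 : ℤ → ℝ) k) =
      fun k => Set.indicator {j} (fun _ => l) k
        - Set.indicator {j + 1} (fun _ => (j : ℝ) + 1 - γ) k := by
    funext k
    by_cases h₁ : k = j <;> by_cases h₂ : k = j + 1 <;> simp_all
  rw [hfun, integral_sub ((integrable_const _).indicator (.singleton _))
    ((integrable_const _).indicator (.singleton _)),
    integral_indicator_const _ (.singleton _), integral_indicator_const _ (.singleton _)] at key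
  simp only [smul_eq_mul] at key
  linarith

theorem ShiftedPoissonRecursion.real_singleton_eq_zero {ν : Measure ℤ} {l : ℝ} {γ : ℤ}
    (h : ShiftedPoissonRecursion ν l γ) (hl : 0 < l) {j : ℤ} (hj : j < γ) :
    ν.real {j} = 0 := by
  have hj' : (j : ℝ) + 1 ≤ γ := by exact_mod_cast hj
  have := h j
  have h₀ : 0 ≤ ν.real {j} := measureReal_nonneg
  have h₁ : 0 ≤ ν.real {j + 1} := measureReal_nonneg
  nlinarith

theorem ShiftedPoissonRecursion.mul_real_singleton {ν ρ : Measure ℤ} {l : ℝ} {γ : ℤ}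
    (hν : ShiftedPoissonRecursion ν l γ) (hρ : ShiftedPoissonRecursion ρ l γ) (hl : 0 < l)
    (j : ℤ) : ν.real {j} * ρ.real {γ} = ρ.real {j} * ν.real {γ} := by
  rcases lt_or_ge j γ with hj | hj
  · rw [hν.real_singleton_eq_zero hl hj, hρ.real_singleton_eq_zero hl hj, zero_mul, zero_mul]
  · induction j, hj using Int.leInduction with
    | base => exact mul_comm _ _
    | succ j hj ih =>
      have hj' : (γ : ℝ) ≤ j := by exact_mod_cast hj
      have hpos : (j : ℝ) + 1 - γ ≠ 0 := by linarith
      apply mul_left_cancel₀ hpos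
      linear_combination l * ih - ρ.real {γ} * hν j + ν.real {γ} * hρ j

theorem tsum_real_singleton (ν : Measure ℤ) [IsProbabilityMeasure ν] :
    ∑' j : ℤ, ν.real {j} = 1 := by
  have := integral_countable (integrable_const (1 : ℝ) (μ := ν))
  simpa using this.symm

theorem ShiftedPoissonRecursion.eq {ν ρ : Measure ℤ} [IsProbabilityMeasure ν]
    [IsProbabilityMeasure ρ] {l : ℝ} {γ : ℤ} (hν : ShiftedPoissonRecursion ν l γ)
    (hρ : ShiftedPoissonRecursion ρ l γ) (hl : 0 < l) (hρ₀ : ρ.real {γ} ≠ 0) : ν = ρ := by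
  have hγ : ρ.real {γ} = ν.real {γ} := by
    have := tsum_congr (L := .unconditional ℤ) (hν.mul_real_singleton hρ hl)
    simpa [tsum_mul_right, tsum_real_singleton] using this
  refine Measure.ext_of_singleton fun j => ?_
  rw [← measureReal_eq_measureReal_iff]
  have := hν.mul_real_singleton hρ hl j
  rw [← hγ] at this
  exact mul_right_cancel₀ hρ₀ this

theorem translatedPoisson_real_floor_add (μ σ2 : ℝ) (hσ : 0 ≤ σ2) (n : ℕ) :
    (translatedPoisson μ σ2).toMeasure.real {⌊μ - σ2⌋ + (n : ℤ)} =
      Real.exp (-(σ2 + Int.fract (μ - σ2))) * (σ2 + Int.fract (μ - σ2)) ^ n / n.factorial := by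
  have hl : 0 ≤ σ2 + Int.fract (μ - σ2) := add_nonneg hσ (Int.fract_nonneg _)
  rw [measureReal_def, PMF.toMeasure_apply_singleton _ _ (.singleton _), translatedPoisson,
    PMF.map_apply, tsum_eq_single n fun m hm => ?_, if_pos rfl,
    ← poissonPMFReal_ofReal_eq_poissonPMF, ENNReal.toReal_ofReal poissonPMFReal_nonneg,
    poissonPMFReal, Real.coe_toNNReal _ hl]
  exact if_neg (by simpa using hm.symm)

theorem translatedPoisson_real_of_lt_floor (μ σ2 : ℝ) {j : ℤ} (hj : j < ⌊μ - σ2⌋) :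
    (translatedPoisson μ σ2).toMeasure.real {j} = 0 := by
  rw [measureReal_def, PMF.toMeasure_apply_singleton _ _ (.singleton _), translatedPoisson,
    PMF.map_apply, ENNReal.tsum_eq_zero.2 fun n => ?_, ENNReal.toReal_zero]
  exact if_neg (by omega)

theorem shiftedPoissonRecursion_translatedPoisson (μ σ2 : ℝ) (hσ : 0 ≤ σ2) :
    ShiftedPoissonRecursion (translatedPoisson μ σ2).toMeasure
      (σ2 + Int.fract (μ - σ2)) ⌊μ - σ2⌋ := by
  intro j
  rcases lt_or_ge j ⌊μ - σ2⌋ with hj | hj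
  · rw [translatedPoisson_real_of_lt_floor μ σ2 hj, mul_zero]
    rcases (Int.add_one_le_iff.2 hj).lt_or_eq with hj' | hj'
    · rw [translatedPoisson_real_of_lt_floor μ σ2 hj', mul_zero]
    · rw [← hj']
      push_cast
      ring
  · obtain ⟨n, rfl⟩ := Int.le.dest hj
    have := translatedPoisson_real_floor_add μ σ2 hσ (n + 1)
    rw [Nat.cast_succ, ← add_assoc] at this
    rw [this, translatedPoisson_real_floor_add μ σ2 hσ n, Nat.factorial_succ]
    push_cast
    have : (n.factorial : ℝ) ≠ 0 := by positivity
    have : (n : ℝ) + 1 ≠ 0 := by positivity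
    have hsub : (⌊μ - σ2⌋ : ℝ) + n + 1 - ⌊μ - σ2⌋ = n + 1 := by ring
    rw [hsub, pow_succ']
    field_simp

/-- An integer-valued random variable `W` with `E|W| < ∞` has distribution `TP(μ,σ²)`
if and only if `E{λ' f(W+1) - (W - γ) f(W)} = 0` for every bounded `f : ℤ → ℝ`, where
`γ := ⌊μ - σ²⌋` and `λ' := σ² + (μ - σ² - γ)`. -/
theorem translatedPoisson_characterization
    {Ω : Type*} [MeasurableSpace Ω] (P : Measure Ω) [IsProbabilityMeasure P]
    (μ σ2 : ℝ) (hσ : 0 < σ2) (W : Ω → ℤ) (hW : Measurable W)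
    (hint : Integrable (fun ω => (W ω : ℝ)) P) :
    P.map W = (translatedPoisson μ σ2).toMeasure ↔
      ∀ f : ℤ → ℝ, (∃ C : ℝ, ∀ j : ℤ, |f j| ≤ C) →
        ∫ ω, ((σ2 + Int.fract (μ - σ2)) * f (W ω + 1)
            - ((W ω : ℝ) - (⌊μ - σ2⌋ : ℝ)) * f (W ω)) ∂P = 0 := by
  have hl : 0 < σ2 + Int.fract (μ - σ2) := add_pos_of_pos_of_nonneg hσ (Int.fract_nonneg _)
  have hrec := shiftedPoissonRecursion_translatedPoisson μ σ2 hσ.le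
  have : IsProbabilityMeasure (P.map W) := Measure.isProbabilityMeasure_map hW.aemeasurable
  have hmap : ∀ f : ℤ → ℝ, ∫ ω, ((σ2 + Int.fract (μ - σ2)) * f (W ω + 1)
      - ((W ω : ℝ) - (⌊μ - σ2⌋ : ℝ)) * f (W ω)) ∂P =
      ∫ j, ((σ2 + Int.fract (μ - σ2)) * f (j + 1) - ((j : ℝ) - ⌊μ - σ2⌋) * f j) ∂(P.map W) :=
    fun f => by rw [integral_map hW.aemeasurable Measurable.of_discrete.aestronglyMeasurable]
  simp only [hmap]
  refine ⟨fun h f ⟨C, hf⟩ => ?_, fun h => ?_⟩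
  · have hint' : Integrable (fun j : ℤ => (j : ℝ)) (P.map W) :=
      (integrable_map_measure Measurable.of_discrete.aestronglyMeasurable hW.aemeasurable).2 hint
    exact integral_stein_eq_zero hint' (h ▸ hrec) hf
  · refine (ShiftedPoissonRecursion.of_integral_eq_zero h).eq hrec hl ?_
    have h₀ := translatedPoisson_real_floor_add μ σ2 hσ.le 0
    rw [Nat.cast_zero, add_zero] at h₀
    rw [h₀]
    positivity
end

section
/- Let Y₁, …, Y_n be integer-valued random variables with finite means (no independence or other dependence assumptions), and set W := Σ_{i=1}^n Y_i. Suppose (a_i)_{i=1}^n and (b_i)_{i=1}^n are real numbers such that for all bounded f : ℤ → ℝ and all 1 ≤ i ≤ n, |E[Y_i f(W)] − E[Y_i] E f(W) − a_i E[Δf(W)]| ≤ b_i ‖Δf‖. Let σ² := Σ_{i=1}^n a_i (assumed positive), δ := E W − σ² − ⌊E W − σ²⌋, and λ' := σ² + δ. Then ‖L(W) − TP(E W, σ²)‖ ≤ 2(λ')⁻¹(δ + Σ_{i=1}^n b_i) + 2 P[W < E W − σ²]. -/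
open MeasureTheory ProbabilityTheory

/-- The total variation norm `‖Q - Q'‖ = ∑_{i ∈ ℤ} |Q(i) - Q'(i)|` of the difference of two
probability measures on `ℤ`. -/
noncomputable def tvNormMeasure (P Q : Measure ℤ) : ℝ :=
  ∑' i : ℤ, |(P {i}).toReal - (Q {i}).toReal|

open Finset in
/-- The Stein equation of a probability sequence `p` on `ℕ` satisfying the Poisson recursion
`r * p j = (j + 1) * p (j + 1)` has, for test functions with values in `[0, 1]`, a bounded
solution with increments at most `1 / r`. -/
lemma exists_stein_solution {p : ℕ → ℝ} {r : ℝ} (hr : 0 < r) (hpos : ∀ j, 0 < p j)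
    (hsum : HasSum p 1) (hrec : ∀ j : ℕ, r * p j = (j + 1) * p (j + 1))
    {h : ℕ → ℝ} (h0 : ∀ j, 0 ≤ h j) (h1 : ∀ j, h j ≤ 1) {m : ℝ}
    (hm : HasSum (fun j => h j * p j) m) :
    ∃ g : ℤ → ℝ, (∃ C : ℝ, ∀ z, |g z| ≤ C) ∧ (∀ z, |g (z + 1) - g z| ≤ r⁻¹) ∧
      (∀ z ≤ 0, g z = 0) ∧ ∀ n : ℕ, r * g (n + 1) - n * g n = h n - m := by
  set F : ℕ → ℝ := fun j => ∑ i ∈ range j, p i with hF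
  set H : ℕ → ℝ := fun j => ∑ i ∈ range j, h i * p i with hH
  have hFs : ∀ j, F (j + 1) = F j + p j := fun j => sum_range_succ _ _
  have hHs : ∀ j, H (j + 1) = H j + h j * p j := fun j => sum_range_succ _ _
  have hx0 : ∀ j, 0 ≤ h j * p j := fun j => mul_nonneg (h0 j) (hpos j).le
  have hx1 : ∀ j, h j * p j ≤ p j := fun j => mul_le_of_le_one_left (hpos j).le (h1 j)
  have hF0 : ∀ j, 0 ≤ F j := fun j => sum_nonneg fun i _ => (hpos i).le
  have hH0 : ∀ j, 0 ≤ H j := fun j => sum_nonneg fun i _ => hx0 i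
  have hHF : ∀ j, H j ≤ F j := fun j => sum_le_sum fun i _ => hx1 i
  have hFt : ∀ j, HasSum (fun i => p (i + j)) (1 - F j) := fun j => (hasSum_nat_add_iff' j).2 hsum
  have hHt : ∀ j, HasSum (fun i => h (i + j) * p (i + j)) (m - H j) := fun j =>
    (hasSum_nat_add_iff' j).2 hm
  have hF1 : ∀ j, F j ≤ 1 := fun j => by linarith [(hFt j).nonneg fun i => (hpos (i + j)).le]
  have hHm : ∀ j, H j ≤ m := fun j => by linarith [(hHt j).nonneg fun i => hx0 (i + j)]
  have hSR : ∀ j, m - H j ≤ 1 - F j := fun j => hasSum_le (fun i => hx1 (i + j)) (hHt j) (hFt j)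
  have head_le : ∀ j : ℕ, r * F j ≤ j * F (j + 1) := by
    intro j
    induction j with
    | zero => simp [hF]
    | succ j ih =>
      rw [hFs (j + 1)]
      push_cast
      nlinarith [hrec j, hF0 (j + 1), hFs j]
  have tail_le : ∀ j : ℕ, j * (1 - F (j + 1)) ≤ r * (1 - F j) := by
    intro j
    refine hasSum_le (fun i => ?_) ((hFt (j + 1)).mul_left (j : ℝ)) ((hFt j).mul_left r)
    have := hrec (i + j)
    rw [this, ← add_assoc]
    push_cast
    nlinarith [hpos (i + j + 1), Nat.cast_nonneg (α := ℝ) i]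
  have tail_le_mass : ∀ n : ℕ, (1 - F (n + 1)) * p 0 ≤ p n := by
    intro n
    induction n with
    | zero => exact mul_le_of_le_one_left (hpos 0).le (by linarith [hF0 1])
    | succ n ih =>
      have ht := tail_le (n + 1)
      push_cast at ht
      have h3 : ((n : ℝ) + 1) * ((1 - F (n + 1 + 1)) * p 0) ≤ (n + 1) * p (n + 1) := by
        rw [← hrec n]
        nlinarith [mul_le_mul_of_nonneg_right ht (hpos 0).le, mul_le_mul_of_nonneg_left ih hr.le]
      exact le_of_mul_le_mul_left h3 (by positivity)
  set D : ℕ → ℝ := fun j => H j - m * F j with hD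
  have hDs : ∀ j, D (j + 1) = D j + (h j - m) * p j := fun j => by
    simp only [hD, hFs, hHs]; ring
  have hD0 : D 0 = 0 := by simp [hD, hF, hH]
  have hDabs : ∀ j, |D j| ≤ 1 - F j := by
    intro j
    have e : D j = H j * (1 - F j) - (m - H j) * F j := by simp only [hD]; ring
    rw [e, abs_le]
    constructor <;>
      nlinarith [mul_nonneg (hH0 j) (sub_nonneg.2 (hF1 j)),
        mul_nonneg (sub_nonneg.2 (hHm j)) (hF0 j),
        mul_nonneg (sub_nonneg.2 ((hHF j).trans (hF1 j))) (sub_nonneg.2 (hF1 j)),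
        mul_nonneg (sub_nonneg.2 (hHm j)) (sub_nonneg.2 (hF1 j)), hSR j]
  set G : ℕ → ℝ := fun n => D n / (n * p n) with hG
  have hGs : ∀ n, r * G (n + 1) = D (n + 1) / p n := by
    intro n
    have := hpos n
    simp only [hG]
    push_cast
    rw [← hrec n]
    field_simp
  have hGn : ∀ n : ℕ, n * G n = D n / p n := by
    intro n
    rcases Nat.eq_zero_or_pos n with rfl | hn
    · simp [hD0]
    · have := hpos n
      have : (0 : ℝ) < n := by exact_mod_cast hn
      simp only [hG]
      field_simp
  have hG0 : G 0 = 0 := by simp [hG]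
  have stein : ∀ n : ℕ, r * G (n + 1) - n * G n = h n - m := by
    intro n
    have := hpos n
    rw [hGs, hGn, hDs]
    field_simp
    ring
  have hGabs : ∀ n, |G n| ≤ (r * p 0)⁻¹ := by
    intro n
    have hp0 := hpos 0
    rcases n with _ | n
    · rw [hG0, abs_zero]; positivity
    · have hpn := hpos n
      have e : G (n + 1) = D (n + 1) / (r * p n) := by
        have := hGs n
        field_simp at this ⊢
        linarith
      rw [e, abs_div, abs_of_pos (mul_pos hr hpn), div_le_iff₀ (mul_pos hr hpn)]
      have : (r * p 0)⁻¹ * (r * p n) = p n / p 0 := by field_simp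
      rw [this, le_div_iff₀ hp0]
      exact (mul_le_mul_of_nonneg_right (hDabs _) hp0.le).trans (tail_le_mass n)
  have hGinc : ∀ n : ℕ, |G (n + 1) - G n| ≤ r⁻¹ := by
    intro n
    have key : |r * (G (n + 1) - G n)| ≤ 1 := by
      rcases Nat.eq_zero_or_pos n with rfl | hn
      · have := stein 0
        simp only [Nat.cast_zero, zero_mul, sub_zero] at this
        rw [hG0, sub_zero, this, abs_le]
        have hm0 := hHm 0
        have hm1 := hSR 0
        simp only [hF, hH, range_zero, sum_empty] at hm0 hm1
        constructor <;> linarith [h0 0, h1 0]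
      · have hp := hpos n
        have hn' : (0 : ℝ) < n := by exact_mod_cast hn
        have e : r * (G (n + 1) - G n) = (n * D (n + 1) - r * D n) / (n * p n) := by
          rw [mul_sub, hGs]
          simp only [hG]
          field_simp
        rw [e, abs_div, abs_of_pos (mul_pos hn' hp), div_le_one (mul_pos hn' hp)]
        have c1 := tail_le n
        have c2 := head_le n
        have e2 : n * D (n + 1) - r * D n = H n * (n * (1 - F (n + 1)) - r * (1 - F n))
            + (m - H (n + 1)) * (r * F n - n * F (n + 1))
            + (h n * p n) * (n * (1 - F (n + 1)) + r * F n) := by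
          simp only [hD, hHs, hFs]; ring
        have e3 : n * D (n + 1) - r * D n
            = -((F n - H n) * (n * (1 - F (n + 1)) - r * (1 - F n))
            + (1 - F (n + 1) - (m - H (n + 1))) * (r * F n - n * F (n + 1))
            + (p n - h n * p n) * (n * (1 - F (n + 1)) + r * F n)) := by
          simp only [hD, hHs, hFs]; ring
        have c3 : n * (1 - F (n + 1)) + r * F n ≤ n := by linarith
        have c3' : 0 ≤ n * (1 - F (n + 1)) + r * F n := by
          have := mul_nonneg hn'.le (sub_nonneg.2 (hF1 (n + 1)))
          have := mul_nonneg hr.le (hF0 n)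
          linarith
        rw [abs_le]
        constructor
        · rw [e3]
          have t1 := mul_nonneg (sub_nonneg.2 (hHF n)) (sub_nonneg.2 c1)
          have t2 := mul_nonneg (sub_nonneg.2 (hSR (n + 1))) (sub_nonneg.2 c2)
          have t3 := mul_le_mul (sub_le_self (p n) (hx0 n)) c3 c3' hp.le
          linarith
        · rw [e2]
          have t1 := mul_nonneg (hH0 n) (sub_nonneg.2 c1)
          have t2 := mul_nonneg (sub_nonneg.2 (hHm (n + 1))) (sub_nonneg.2 c2)
          have t3 := mul_le_mul (hx1 n) c3 c3' hp.le
          linarith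
    rw [abs_mul, abs_of_pos hr] at key
    rwa [← one_div, le_div_iff₀' hr]
  refine ⟨fun z => G z.toNat, ⟨_, fun z => hGabs _⟩, fun z => ?_, fun z hz => ?_, fun n => ?_⟩
  · rcases lt_or_ge z 0 with hz | hz
    · simp only [Int.toNat_of_nonpos hz.le, Int.toNat_of_nonpos (show z + 1 ≤ 0 by lia), sub_self,
        abs_zero]
      positivity
    · lift z to ℕ using hz
      exact hGinc z
  · simp only [Int.toNat_of_nonpos hz, hG0]
  · exact stein n

lemma integrable_of_abs_le {α : Type*} [MeasurableSpace α] {μ : Measure α} [IsFiniteMeasure μ]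
    {f : α → ℝ} (hf : Measurable f) {C : ℝ} (hC : ∀ x, |f x| ≤ C) : Integrable f μ :=
  Integrable.of_bound hf.aestronglyMeasurable C (ae_of_all _ hC)

/-- The total variation norm is attained, up to a factor two, by a `[0, 1]`-valued function. -/
lemma exists_tvNormMeasure_eq (P Q : Measure ℤ) [IsProbabilityMeasure P]
    [IsProbabilityMeasure Q] :
    ∃ h : ℤ → ℝ, (∀ z, 0 ≤ h z) ∧ (∀ z, h z ≤ 1) ∧
      tvNormMeasure P Q = 2 * (∫ z, h z ∂P - ∫ z, h z ∂Q) := by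
  classical
  refine ⟨fun z => if (Q {z}).toReal ≤ (P {z}).toReal then 1 else 0, fun z => ?_, fun z => ?_, ?_⟩
  · dsimp only; split_ifs <;> norm_num
  · dsimp only; split_ifs <;> norm_num
  set h : ℤ → ℝ := fun z => if (Q {z}).toReal ≤ (P {z}).toReal then 1 else 0 with hh
  have hb : ∀ z, |h z| ≤ 1 := fun z => by simp only [hh]; split_ifs <;> norm_num
  have hs : ∀ (ν : Measure ℤ) [IsProbabilityMeasure ν],
      HasSum (fun z : ℤ => (ν {z}).toReal * h z) (∫ z, h z ∂ν) ∧
        HasSum (fun z : ℤ => (ν {z}).toReal) 1 := by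
    intro ν _
    have hone : HasSum (fun z => (ν {z}).toReal) 1 := by
      have hν : ∑' z, ν {z} = 1 := by
        have := lintegral_countable' (μ := ν) (fun _ => 1)
        simpa using this.symm
      have := ENNReal.hasSum_toReal (f := fun z => ν {z}) (by rw [hν]; simp)
      rwa [← ENNReal.tsum_toReal_eq (fun z => measure_ne_top ν _), hν, ENNReal.toReal_one] at this
    refine ⟨?_, hone⟩
    rw [integral_countable (integrable_of_abs_le .of_discrete hb)]
    refine (Summable.of_norm_bounded hone.summable fun z => ?_).hasSum
    rw [Real.norm_eq_abs, abs_mul, abs_of_nonneg ENNReal.toReal_nonneg]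
    exact mul_le_of_le_one_right ENNReal.toReal_nonneg (hb z)
  have key := (((hs P).1.sub (hs Q).1).mul_left 2).sub ((hs P).2.sub (hs Q).2)
  rw [sub_self, sub_zero] at key
  rw [tvNormMeasure, ← key.tsum_eq]
  congr 1 with z
  simp only [hh]
  split_ifs with hz
  · rw [abs_of_nonneg (sub_nonneg.2 hz)]; ring
  · rw [abs_of_neg (by linarith)]; ring

lemma hasSum_integral_translatedPoisson {μ σ2 : ℝ} (hσ : 0 < σ2) {h : ℤ → ℝ}
    (hb : ∀ z, |h z| ≤ 1) :
    HasSum (fun n : ℕ => h (⌊μ - σ2⌋ + n) * (Real.exp (-(σ2 + Int.fract (μ - σ2)))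
        * (σ2 + Int.fract (μ - σ2)) ^ n / n.factorial))
      (∫ z, h z ∂(translatedPoisson μ σ2).toMeasure) := by
  set r := σ2 + Int.fract (μ - σ2) with hr
  have hr0 : 0 ≤ r := add_nonneg hσ.le (Int.fract_nonneg _)
  set k : ℕ → ℝ := fun n => h (⌊μ - σ2⌋ + n)
  have hp := hasSum_one_poissonMeasure r.toNNReal
  rw [Real.coe_toNNReal _ hr0] at hp
  have hnn : ∀ n : ℕ, 0 ≤ Real.exp (-r) * r ^ n / n.factorial := fun n => by positivity
  rw [translatedPoisson, ← PMF.toMeasure_map _ _ Measurable.of_discrete,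
    integral_map Measurable.of_discrete.aemeasurable
      Measurable.of_discrete.aestronglyMeasurable,
    PMF.integral_eq_tsum _ _ (integrable_of_abs_le .of_discrete fun n => hb _)]
  have e : ∀ n : ℕ, (poissonPMF r.toNNReal n).toReal • k n
      = k n * (Real.exp (-r) * r ^ n / n.factorial) := by
    intro n
    change (ENNReal.ofReal (Real.exp (-(r.toNNReal : ℝ)) * (r.toNNReal : ℝ) ^ n
      / n.factorial)).toReal • k n = _
    rw [Real.coe_toNNReal _ hr0, ENNReal.toReal_ofReal (hnn n), smul_eq_mul, mul_comm]
  change HasSum _ (∑' n, (poissonPMF r.toNNReal n).toReal • k n)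
  rw [tsum_congr e]
  refine (Summable.of_norm_bounded hp.summable fun n => ?_).hasSum
  rw [Real.norm_eq_abs, abs_mul, abs_of_nonneg (hnn n)]
  exact mul_le_of_le_one_left (hnn n) (hb _)

/-- Let `Y₁, …, Y_n` be integer-valued random variables with finite means (no dependence
assumption), `W := Σ_{i=1}^n Y_i`. Suppose `(a_i)`, `(b_i)` are reals such that for all
bounded `f : ℤ → ℝ`, `|E[Y_i f(W)] - E[Y_i] E f(W) - a_i E[Δf(W)]| ≤ b_i ‖Δf‖` for each `i`
(here expressed via every upper bound `c` for `‖Δf‖`).  With `σ² := Σ a_i > 0`,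
`δ := E W - σ² - ⌊E W - σ²⌋` and `λ' := σ² + δ`, one has
`‖L(W) - TP(E W, σ²)‖ ≤ 2 λ'⁻¹ (δ + Σ b_i) + 2 P[W < E W - σ²]`. -/
theorem translatedPoisson_approximation_bound
    {Ω : Type*} [MeasurableSpace Ω] (P : Measure Ω) [IsProbabilityMeasure P]
    (n : ℕ) (Y : Fin n → Ω → ℤ) (hmeas : ∀ i, Measurable (Y i))
    (hint : ∀ i, Integrable (fun ω => (Y i ω : ℝ)) P)
    (a b : Fin n → ℝ)
    (hab : ∀ (f : ℤ → ℝ), (∃ C : ℝ, ∀ j : ℤ, |f j| ≤ C) →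
      ∀ c : ℝ, (∀ j : ℤ, |f (j + 1) - f j| ≤ c) →
      ∀ i : Fin n,
        |∫ ω, (Y i ω : ℝ) * f (∑ k, Y k ω) ∂P
          - (∫ ω, (Y i ω : ℝ) ∂P) * (∫ ω, f (∑ k, Y k ω) ∂P)
          - a i * ∫ ω, (f ((∑ k, Y k ω) + 1) - f (∑ k, Y k ω)) ∂P| ≤ b i * c)
    (hσ : 0 < ∑ i, a i) :
    tvNormMeasure (P.map (fun ω => ∑ k, Y k ω))
        (translatedPoisson (∫ ω, ((∑ k, Y k ω : ℤ) : ℝ) ∂P) (∑ i, a i)).toMeasure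
      ≤ 2 * ((∑ i, a i) + Int.fract ((∫ ω, ((∑ k, Y k ω : ℤ) : ℝ) ∂P) - ∑ i, a i))⁻¹
          * (Int.fract ((∫ ω, ((∑ k, Y k ω : ℤ) : ℝ) ∂P) - ∑ i, a i) + ∑ i, b i)
        + 2 * (P {ω | ((∑ k, Y k ω : ℤ) : ℝ)
            < (∫ ω, ((∑ k, Y k ω : ℤ) : ℝ) ∂P) - ∑ i, a i}).toReal := by
  classical
  set W : Ω → ℤ := fun ω => ∑ k, Y k ω with hW
  set s := ∑ i, a i with hs
  set μ := ∫ ω, ((∑ k, Y k ω : ℤ) : ℝ) ∂P with hμ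
  set δ := Int.fract (μ - s)
  set γ := ⌊μ - s⌋
  set r := s + δ with hr
  have hδ0 : 0 ≤ δ := Int.fract_nonneg _
  have hr0 : 0 < r := by linarith
  have hγδ : (γ : ℝ) + δ = μ - s := Int.floor_add_fract _
  have hWm : Measurable W := Finset.measurable_sum _ fun i _ => hmeas i
  have : IsProbabilityMeasure (P.map W) := Measure.isProbabilityMeasure_map hWm.aemeasurable
  obtain ⟨h, h0, h1, htv⟩ := exists_tvNormMeasure_eq (P.map W) (translatedPoisson μ s).toMeasure
  have hb : ∀ z, |h z| ≤ 1 := fun z => abs_le.2 ⟨by linarith [h0 z], h1 z⟩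
  have hm := hasSum_integral_translatedPoisson (μ := μ) hσ hb
  set m := ∫ z, h z ∂(translatedPoisson μ s).toMeasure
  have hm0 : 0 ≤ m := integral_nonneg h0
  rw [htv, integral_map hWm.aemeasurable Measurable.of_discrete.aestronglyMeasurable]
  have hsum := hasSum_one_poissonMeasure r.toNNReal
  rw [Real.coe_toNNReal _ hr0.le] at hsum
  obtain ⟨g, ⟨C, hC⟩, hinc, hneg, heq⟩ := exists_stein_solution hr0
    (fun j => by positivity) hsum
    (fun j => by rw [Nat.factorial_succ]; push_cast; field_simp; ring)
    (fun j => h0 (γ + j)) (fun j => h1 (γ + j)) hm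
  set f : ℤ → ℝ := fun z => g (z - γ) with hf
  have hfC : ∀ z, |f z| ≤ C := fun z => hC _
  have hfinc : ∀ z, |f (z + 1) - f z| ≤ r⁻¹ := fun z => by
    have := hinc (z - γ)
    simpa only [hf, sub_add_eq_add_sub] using this
  have hYf : ∀ i, Integrable (fun ω => (Y i ω : ℝ) * f (W ω)) P := fun i =>
    (hint i).mul_bdd (c := C) ((Measurable.of_discrete (f := f)).comp hWm).aestronglyMeasurable
      (ae_of_all _ fun ω => hfC _)
  have hfI : Integrable (fun ω => f (W ω)) P :=
    integrable_of_abs_le ((Measurable.of_discrete (f := f)).comp hWm) fun ω => hfC _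
  have hΔI : Integrable (fun ω => f (W ω + 1) - f (W ω)) P :=
    integrable_of_abs_le
      ((Measurable.of_discrete (f := fun z : ℤ => f (z + 1) - f z)).comp hWm) fun ω => hfinc _
  have hhI : Integrable (fun ω => h (W ω)) P :=
    integrable_of_abs_le (Measurable.of_discrete.comp hWm) fun ω => hb _
  have hWfI : Integrable (fun ω => (W ω : ℝ) * f (W ω)) P := by
    have := integrable_finsetSum Finset.univ fun i _ => hYf i
    refine this.congr (ae_of_all _ fun ω => ?_)
    simp only [hW, Int.cast_sum, Finset.sum_mul]
  have hWf : ∫ ω, (W ω : ℝ) * f (W ω) ∂P = ∑ i, ∫ ω, (Y i ω : ℝ) * f (W ω) ∂P := by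
    rw [← integral_finsetSum _ fun i _ => hYf i]
    simp only [hW, Int.cast_sum, Finset.sum_mul]
  have hμsum : μ = ∑ i, ∫ ω, (Y i ω : ℝ) ∂P := by
    rw [← integral_finsetSum _ fun i _ => hint i]
    simp only [hμ, Int.cast_sum]
  have hmain : |∫ ω, (W ω : ℝ) * f (W ω) ∂P - μ * ∫ ω, f (W ω) ∂P
      - s * ∫ ω, (f (W ω + 1) - f (W ω)) ∂P| ≤ (∑ i, b i) * r⁻¹ := by
    rw [hWf, hμsum, hs, Finset.sum_mul, Finset.sum_mul, Finset.sum_mul,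
      ← Finset.sum_sub_distrib, ← Finset.sum_sub_distrib]
    exact (Finset.abs_sum_le_sum_abs _ _).trans
      (Finset.sum_le_sum fun i _ => hab f ⟨C, hfC⟩ _ hfinc i)
  have hΔ : |∫ ω, (f (W ω + 1) - f (W ω)) ∂P| ≤ r⁻¹ := by
    have := norm_integral_le_of_norm_le_const (μ := P) (f := fun ω => f (W ω + 1) - f (W ω))
      (ae_of_all _ fun ω => hfinc (W ω))
    simpa using this
  set A : Set Ω := {ω | (W ω : ℝ) < μ - s} with hA
  have hAm : MeasurableSet A :=
    measurableSet_lt ((Measurable.of_discrete (f := fun z : ℤ => (z : ℝ))).comp hWm)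
      measurable_const
  have hpt : ∀ ω, h (W ω) - m ≤ r * (f (W ω + 1) - f (W ω))
      - ((W ω : ℝ) * f (W ω) - μ * f (W ω)) + A.indicator 1 ω := by
    intro ω
    have e : r * (f (W ω + 1) - f (W ω)) - ((W ω : ℝ) * f (W ω) - μ * f (W ω))
        = r * g (W ω - γ + 1) - ((W ω : ℝ) - γ) * g (W ω - γ) := by
      have : μ = r + γ := by linarith
      simp only [hf, sub_add_eq_add_sub, this]
      ring
    rw [e]
    rcases lt_or_ge (W ω) γ with hlt | hge
    · have hmem : ω ∈ A := by
        have : (W ω : ℝ) < γ := by exact_mod_cast hlt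
        exact lt_of_lt_of_le this (by linarith)
      rw [hneg _ (by lia), hneg _ (by lia), Set.indicator_of_mem hmem, Pi.one_apply]
      linarith [h1 (W ω)]
    · obtain ⟨k, hk⟩ := Int.le.dest hge
      have hn := heq k
      have hind : (0 : ℝ) ≤ A.indicator 1 ω :=
        Set.indicator_nonneg (fun _ _ => zero_le_one) _
      rw [← hk, add_sub_cancel_left]
      push_cast
      linarith
  have hindI : Integrable (A.indicator (1 : Ω → ℝ)) P := (integrable_const 1).indicator hAm
  have hdiff : Integrable (fun ω => (W ω : ℝ) * f (W ω) - μ * f (W ω)) P :=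
    hWfI.sub (hfI.const_mul μ)
  have hstein : Integrable (fun ω => r * (f (W ω + 1) - f (W ω))
      - ((W ω : ℝ) * f (W ω) - μ * f (W ω))) P := (hΔI.const_mul r).sub hdiff
  have hle := integral_mono (hhI.sub (integrable_const m)) (hstein.add hindI) hpt
  simp only [Pi.add_apply, Pi.sub_apply] at hle
  rw [integral_sub hhI (integrable_const m), integral_add hstein hindI,
    integral_sub (hΔI.const_mul r) hdiff, integral_sub hWfI (hfI.const_mul μ),
    integral_const_mul, integral_const_mul, integral_indicator_one hAm, integral_const,
    probReal_univ, one_smul, measureReal_def] at hle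
  have hδΔ := mul_le_mul_of_nonneg_left (le_of_abs_le hΔ) hδ0
  have hlow := neg_le_of_abs_le hmain
  have hrΔ := add_mul s δ (∫ ω, (f (W ω + 1) - f (W ω)) ∂P)
  linarith
end

section
/- Let Q be a probability distribution on ℤ whose support is not contained in any coset a + dℤ with d ≥ 2 (equivalently, g.c.d.{x − y : x, y ∈ supp Q} = 1). Let V₁, V₂, … be i.i.d. with distribution Q, let M be independent of the V_j's with the geometric distribution Ge(1/2) on {1,2,…} (P(M = m) = 2^{−m}), and let Q̂ be the distribution of Σ_{m=1}^M V_m. Then Q̂ is strongly aperiodic, i.e. g.c.d.{k + i : Q̂(i) > 0} = 1 for all integers k. -/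
open scoped ENNReal

/-- The `m`-fold convolution power of a distribution `Q` on `ℤ`: the law of the sum of `m`
i.i.d. variables with law `Q`. -/
noncomputable def convPow (Q : PMF ℤ) : ℕ → PMF ℤ
  | 0 => PMF.pure 0
  | m + 1 => (convPow Q m).bind fun s => Q.map fun v => s + v

/-- The law `Q̂` of `Σ_{m=1}^M V_m`, where the `V_j` are i.i.d. with law `Q` and `M` is an
independent geometric `Ge(1/2)` variable on `{1, 2, …}` (`P(M = m) = 2^{-m}`). -/
noncomputable def geomMix (Q : PMF ℤ) (i : ℤ) : ℝ≥0∞ :=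
  ∑' m : ℕ, (2 : ℝ≥0∞)⁻¹ ^ (m + 1) * (convPow Q (m + 1)) i

theorem convPow_succ_add_ne_zero {Q : PMF ℤ} {m : ℕ} {s v : ℤ} (hs : convPow Q m s ≠ 0)
    (hv : Q v ≠ 0) : convPow Q (m + 1) (s + v) ≠ 0 := by
  rw [← PMF.mem_support_iff] at *
  rw [convPow, PMF.mem_support_bind_iff]
  exact ⟨s, hs, (PMF.mem_support_map_iff _ _ _).2 ⟨v, hv, rfl⟩⟩

theorem convPow_one_ne_zero {Q : PMF ℤ} {v : ℤ} (hv : Q v ≠ 0) : convPow Q 1 v ≠ 0 := by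
  have h0 : convPow Q 0 0 ≠ 0 := by simp [convPow]
  simpa using convPow_succ_add_ne_zero h0 hv

theorem geomMix_ne_zero_of_convPow {Q : PMF ℤ} {m : ℕ} {i : ℤ}
    (h : convPow Q (m + 1) i ≠ 0) : geomMix Q i ≠ 0 := by
  rw [geomMix, Ne, ENNReal.tsum_eq_zero, not_forall]
  exact ⟨m, mul_ne_zero (pow_ne_zero _ (by simp)) h⟩

/-- If the support of `Q` is not contained in any coset `a + dℤ` with `d ≥ 2`, then the
geometric mixture `Q̂` of the convolution powers of `Q` is strongly aperiodic:
`g.c.d. {k + i : Q̂(i) > 0} = 1` for every integer `k`. -/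
theorem geomMix_stronglyAperiodic (Q : PMF ℤ)
    (hQ : ∀ a d : ℤ, 2 ≤ d → ∃ x : ℤ, Q x ≠ 0 ∧ ¬ d ∣ (x - a)) :
    ∀ k d : ℤ, (∀ i : ℤ, geomMix Q i ≠ 0 → d ∣ (k + i)) → IsUnit d := by
  intro k d hd
  have hsupp : ∀ y : ℤ, Q y ≠ 0 → d ∣ y := by
    intro y hy
    have h₁ := hd y (geomMix_ne_zero_of_convPow (convPow_one_ne_zero hy))
    have h₂ := hd (y + y)
      (geomMix_ne_zero_of_convPow (convPow_succ_add_ne_zero (convPow_one_ne_zero hy) hy))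
    rw [← add_assoc] at h₂
    exact (dvd_add_right h₁).1 h₂
  rw [Int.isUnit_iff_abs_eq]
  by_contra hne
  obtain rfl | hd0 := eq_or_ne d 0
  · obtain ⟨x, hx, hx'⟩ := hQ 0 2 le_rfl
    exact hx' (by simp [zero_dvd_iff.1 (hsupp x hx)])
  · have hpos := abs_pos.2 hd0
    obtain ⟨x, hx, hx'⟩ := hQ 0 |d| (by omega)
    exact hx' (by simpa using hsupp x hx)
end

section
/- Let d ≥ 1 and let p : ℤ/dℤ → [0,1] satisfy Σ_{s∈ℤ/dℤ} p(s) = 1. If the convolution of p with itself is constant, i.e. Σ_{s∈ℤ/dℤ} p(s) p(r − s) = 1/d for every r ∈ ℤ/dℤ, then p(r) = 1/d for every r ∈ ℤ/dℤ. -/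
open scoped ZMod in
/-- The discrete Fourier transform turns convolution into pointwise multiplication. -/
lemma ZMod.dft_convolution {d : ℕ} [NeZero d] (f g : ZMod d → ℂ) (k : ZMod d) :
    𝓕 (fun r ↦ ∑ s, f s * g (r - s)) k = 𝓕 f k * 𝓕 g k := by
  simp only [ZMod.dft_apply, smul_eq_mul]
  simp_rw [Finset.sum_mul_sum, Finset.mul_sum]
  rw [Finset.sum_comm]
  refine Finset.sum_congr rfl fun s _ ↦ ?_
  rw [← Equiv.sum_comp (Equiv.addRight s)]
  refine Finset.sum_congr rfl fun t _ ↦ ?_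
  rw [Equiv.coe_addRight, add_sub_cancel_right, add_mul, neg_add, AddChar.map_add_eq_mul]
  ring

open scoped ZMod in
/-- A function on `ZMod d` whose convolution with itself vanishes is zero. -/
lemma ZMod.eq_zero_of_selfConv_eq_zero {d : ℕ} [NeZero d] {f : ZMod d → ℂ}
    (hf : ∀ r, ∑ s, f s * f (r - s) = 0) : f = 0 := by
  rw [← (ZMod.dft (N := d) (E := ℂ)).map_eq_zero_iff]
  funext k
  have h := ZMod.dft_convolution f f k
  simpa [funext hf, ← Pi.zero_def] using h.symm


/-- Let `d ≥ 1` and `p : ℤ/dℤ → [0,1]` with `Σ_s p(s) = 1`.  If the convolution of `p`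
with itself is constant, i.e. `Σ_s p(s) p(r - s) = 1/d` for every `r`, then `p(r) = 1/d`
for every `r`. -/
theorem selfConv_const_imp_uniform (d : ℕ) [NeZero d] (p : ZMod d → ℝ)
    (hp0 : ∀ s, 0 ≤ p s) (hp1 : ∀ s, p s ≤ 1) (hsum : ∑ s : ZMod d, p s = 1)
    (hconv : ∀ r : ZMod d, ∑ s : ZMod d, p s * p (r - s) = 1 / d) :
    ∀ r : ZMod d, p r = 1 / d := by
  have hd : (d : ℝ) ≠ 0 := NeZero.ne _
  have hq : ∀ r, ∑ s, (p s - 1 / d) * (p (r - s) - 1 / d) = 0 := by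
    intro r
    have hs : ∑ s, p (r - s) = 1 := by
      rw [← hsum]
      exact Equiv.sum_comp (Equiv.subLeft r) p
    simp only [sub_mul, mul_sub, Finset.sum_sub_distrib, ← Finset.sum_mul, ← Finset.mul_sum,
      hconv, hsum, hs, Finset.sum_const, Finset.card_univ, ZMod.card, nsmul_eq_mul]
    field_simp
    ring
  have hz : (fun s ↦ ((p s - 1 / d : ℝ) : ℂ)) = 0 :=
    ZMod.eq_zero_of_selfConv_eq_zero fun r ↦ by exact_mod_cast hq r
  intro r
  exact sub_eq_zero.mp (Complex.ofReal_eq_zero.mp (congrFun hz r))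
end

section
/- In the hidden Markov setting, suppose Q := L(Σ_{i=1}^{S₁} Y_i | X₀ = 0) is concentrated on dℤ for some integer d ≥ 2 (Q has period d). Then there exist maps r : E → ℤ/dℤ and ρ : E → ℤ/dℤ with r(0) = 0 such that: (i) for every k ∈ E, the conditional distribution L(Y₁ | X₁ = k) is concentrated on the coset dℤ + ρ(k); (ii) for every i ≥ 1 and k ∈ E, conditional on X₀ = 0 and X_i = k, Σ_{l=1}^i Y_l ≡ r(k) (mod d) almost surely; and (iii) the transition matrix P = (p_{kj}) of the chain satisfies r(k) + ρ(j) ≡ r(j) (mod d) whenever p_{kj} > 0. -/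
open MeasureTheory ProbabilityTheory

/-- `HiddenWalk P ν i s j`: some walk of positive length from `i` to `j` along transitions of
positive probability can emit, at the states after `i`, integers in the supports of the emission
laws with sum `s`. -/
inductive HiddenWalk {E : Type*} (P : Matrix E E ℝ) (ν : E → PMF ℤ) : E → ℤ → E → Prop
  | single {i j : E} {y : ℤ} (hP : 0 < P i j) (hy : ν j y ≠ 0) : HiddenWalk P ν i y j
  | tail {i k j : E} {s y : ℤ} (h : HiddenWalk P ν i s k) (hP : 0 < P k j) (hy : ν j y ≠ 0) :
      HiddenWalk P ν i (s + y) j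

namespace HiddenWalk

variable {E : Type*} {P : Matrix E E ℝ} {ν : E → PMF ℤ}

theorem trans {i j k : E} {s t : ℤ} (h : HiddenWalk P ν i s j) (h' : HiddenWalk P ν j t k) :
    HiddenWalk P ν i (s + t) k := by
  induction h' with
  | single hP hy => exact h.tail hP hy
  | tail _ hP hy ih => rw [← add_assoc]; exact ih.tail hP hy

theorem exists_pred {i j : E} {s : ℤ} (h : HiddenWalk P ν i s j) : ∃ k, 0 < P k j := by
  cases h with
  | single hP _ => exact ⟨_, hP⟩
  | tail _ hP _ => exact ⟨_, hP⟩

theorem exists_of_pow_ne_zero [Fintype E] [DecidableEq E] (hP : ∀ i j, 0 ≤ P i j) {m : ℕ}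
    {i j : E} (h : (P ^ (m + 1)) i j ≠ 0) : ∃ s, HiddenWalk P ν i s j := by
  have hν (k : E) : ∃ y, ν k y ≠ 0 := (ν k).support_nonempty
  obtain ⟨y, hy⟩ := hν j
  induction m generalizing j y with
  | zero => exact ⟨y, single ((hP i j).lt_of_ne' (by simpa using h)) hy⟩
  | succ m ih =>
    rw [pow_succ, Matrix.mul_apply] at h
    obtain ⟨k, -, hk⟩ := Finset.exists_ne_zero_of_sum_ne_zero h
    obtain ⟨y', hy'⟩ := hν k
    obtain ⟨s, hs⟩ := ih (left_ne_zero_of_mul hk) y' hy'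
    exact ⟨s + y, hs.tail ((hP k j).lt_of_ne' (right_ne_zero_of_mul hk)) hy⟩

theorem of_path {x : ℕ → E} {y : ℕ → ℤ} {n : ℕ} (hP : ∀ i ≤ n, 0 < P (x i) (x (i + 1)))
    (hy : ∀ i ≤ n + 1, ν (x i) (y i) ≠ 0) :
    HiddenWalk P ν (x 0) (∑ l ∈ Finset.Icc 1 (n + 1), y l) (x (n + 1)) := by
  induction n with
  | zero => simpa using single (hP 0 le_rfl) (hy 1 le_rfl)
  | succ n ih =>
    rw [Finset.sum_Icc_succ_top (by omega)]
    exact (ih (fun i hi => hP i (by omega)) fun i hi => hy i (by omega)).tail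
      (hP _ le_rfl) (hy _ le_rfl)

end HiddenWalk

/-- A path of positive length `m` of positive probability, starting at `a`, ending at `j` and not
visiting `a` in between, whose emissions after time `0` have sum `s`. -/
structure IsExcursion {E : Type*} (P : Matrix E E ℝ) (ν : E → PMF ℤ) (a : E) (m : ℕ)
    (x : ℕ → E) (y : ℕ → ℤ) (s : ℤ) (j : E) : Prop where
  pos : 1 ≤ m
  start : x 0 = a
  finish : x m = j
  avoid : ∀ i, 1 ≤ i → i < m → x i ≠ a
  step : ∀ i < m, 0 < P (x i) (x (i + 1))
  emit : ∀ i ≤ m, ν (x i) (y i) ≠ 0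
  sum_eq : ∑ l ∈ Finset.Icc 1 m, y l = s

namespace IsExcursion

variable {E : Type*} {P : Matrix E E ℝ} {ν : E → PMF ℤ} {a : E}

theorem exists_of_step {j : E} {y : ℤ} (hP : 0 < P a j) (hy : ν j y ≠ 0) :
    ∃ m x z, IsExcursion P ν a m x z y j := by
  obtain ⟨y₀, hy₀⟩ := (ν a).support_nonempty
  rw [PMF.mem_support_iff] at hy₀
  refine ⟨1, fun n => if n = 0 then a else j, fun n => if n = 0 then y₀ else y,
    le_rfl, by simp, by simp, fun i h h' => by omega, fun i hi => ?_, fun i hi => ?_, by simp⟩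
  · obtain rfl : i = 0 := by omega
    simpa using hP
  · split_ifs
    exacts [hy₀, hy]

theorem exists_tail {m : ℕ} {x : ℕ → E} {z : ℕ → ℤ} {s y : ℤ} {k j : E}
    (h : IsExcursion P ν a m x z s k) (hk : k ≠ a) (hP : 0 < P k j) (hy : ν j y ≠ 0) :
    ∃ m' x' z', IsExcursion P ν a m' x' z' (s + y) j := by
  have hx : ∀ i ≤ m, (if i ≤ m then x i else j) = x i := fun i hi => if_pos hi
  have hz : ∀ i ≤ m, (if i ≤ m then z i else y) = z i := fun i hi => if_pos hi
  refine ⟨m + 1, fun n => if n ≤ m then x n else j, fun n => if n ≤ m then z n else y,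
    by omega, by simpa using h.start, by simp, fun i h1 h2 => ?_, fun i hi => ?_,
    fun i hi => ?_, ?_⟩
  · rw [hx i (by omega)]
    rcases (Nat.lt_succ_iff.mp h2).lt_or_eq with h3 | rfl
    · exact h.avoid i h1 h3
    · rwa [h.finish]
  · rcases (Nat.lt_succ_iff.mp hi).lt_or_eq with h3 | rfl
    · rw [hx i h3.le, hx (i + 1) h3]
      exact h.step i h3
    · rw [hx i le_rfl, h.finish, if_neg (by omega)]
      exact hP
  · split_ifs with h3
    exacts [h.emit i h3, hy]
  · rw [Finset.sum_Icc_succ_top (by omega), if_neg (by omega), ← h.sum_eq]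
    congr 1
    exact Finset.sum_congr rfl fun i hi => hz i (Finset.mem_Icc.mp hi).2

end IsExcursion

/-- If all excursions from `a` back to `a` emit multiples of `d`, then every walk from `a` is
congruent modulo `d` to an excursion with the same endpoint. -/
theorem HiddenWalk.exists_excursion {E : Type*} {P : Matrix E E ℝ} {ν : E → PMF ℤ} {a j : E}
    {d s : ℤ} (hd : ∀ m x z t, IsExcursion P ν a m x z t a → d ∣ t)
    (h : HiddenWalk P ν a s j) :
    ∃ t m x z, IsExcursion P ν a m x z t j ∧ d ∣ s - t := by
  induction h with
  | single hP hy =>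
    obtain ⟨m, x, z, h⟩ := IsExcursion.exists_of_step hP hy
    exact ⟨_, m, x, z, h, by simp⟩
  | @tail k j s y _ hP hy ih =>
    obtain ⟨t, m, x, z, h, hst⟩ := ih
    by_cases hk : k = a
    · subst hk
      obtain ⟨m', x', z', h'⟩ := IsExcursion.exists_of_step hP hy
      refine ⟨_, m', x', z', h', ?_⟩
      have := dvd_add hst (hd _ _ _ _ h)
      simpa using this
    · obtain ⟨m', x', z', h'⟩ := h.exists_tail hk hP hy
      exact ⟨_, m', x', z', h', by simpa using hst⟩

theorem HiddenWalk.dvd_of_closed {E : Type*} {P : Matrix E E ℝ} {ν : E → PMF ℤ} {a : E}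
    {d s : ℤ} (hd : ∀ m x z t, IsExcursion P ν a m x z t a → d ∣ t)
    (h : HiddenWalk P ν a s a) : d ∣ s := by
  obtain ⟨t, m, x, z, ht, hst⟩ := h.exists_excursion hd
  simpa using dvd_add hst (hd _ _ _ _ ht)

/-- If closed walks at `a` emit multiples of `d` and every state lies on a closed walk through
`a`, then walks from `a` to a given state all emit the same residue modulo `d`. -/
theorem exists_residue_of_closed_walks {E : Type*} {P : Matrix E E ℝ} {ν : E → PMF ℤ} {a : E}
    {d : ℕ} (hconn : ∀ i j, ∃ s, HiddenWalk P ν i s j)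
    (hclosed : ∀ s, HiddenWalk P ν a s a → (d : ℤ) ∣ s) :
    ∃ r : E → ZMod d, ∀ s k, HiddenWalk P ν a s k → (s : ZMod d) = r k := by
  choose t ht using fun k => hconn k a
  refine ⟨fun k => -(t k : ZMod d), fun s k h => eq_neg_of_add_eq_zero_left ?_⟩
  have := (ZMod.intCast_zmod_eq_zero_iff_dvd _ d).mpr (hclosed _ (h.trans (ht k)))
  exact_mod_cast this

/-- Countably-valued random sequences almost surely follow finite paths of non-zero
probability. -/
theorem ae_path_prob_ne_zero {Ω S : Type*} [MeasurableSpace Ω] [Countable S]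
    {μ : Measure Ω} (Z : ℕ → Ω → S) (m : ℕ) :
    ∀ᵐ ω ∂μ, μ (⋂ i ∈ Finset.range (m + 1), {ω' | Z i ω' = Z i ω}) ≠ 0 := by
  rw [ae_iff]
  let B : (Fin (m + 1) → S) → Set Ω := fun z => {ω | ∀ i : Fin (m + 1), Z i ω = z i}
  refine measure_mono_null (t := ⋃ z ∈ {z | μ (B z) = 0}, B z) (fun ω hω => ?_)
    ((measure_biUnion_null_iff (Set.to_countable _)).mpr fun z hz => hz)
  rw [Set.mem_ofPred_eq, not_not] at hω
  refine Set.mem_biUnion (x := fun i : Fin (m + 1) => Z i ω)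
    (measure_mono_null (fun ω' h => ?_) hω) fun i => rfl
  simp only [Set.mem_iInter, Finset.mem_range]
  exact fun i hi => h ⟨i, hi⟩

/-- In the hidden Markov setting started at `0`, suppose
`Q := L(Σ_{i=1}^{S₁} Y_i | X₀ = 0)` is concentrated on `dℤ` for some `d ≥ 2`.  Then there
are maps `r, ρ : E → ℤ/dℤ` with `r(0) = 0` such that: (i) `L(Y₁ | X₁ = k)` is concentrated
on the coset `dℤ + ρ(k)`; (ii) conditional on `X₀ = 0` and `X_i = k`,
`Σ_{l=1}^i Y_l ≡ r(k) (mod d)` a.s.; and (iii) `r(k) + ρ(j) ≡ r(j) (mod d)` whenever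
`p_{kj} > 0`. -/
theorem periodic_Q_structure
    {Ω : Type*} [MeasurableSpace Ω] (Pr : Measure Ω) [IsProbabilityMeasure Pr]
    (K : ℕ) (X : ℕ → Ω → Fin (K + 1)) (Y : ℕ → Ω → ℤ)
    (hmX : ∀ i, Measurable (X i)) (hmY : ∀ i, Measurable (Y i))
    (P : Matrix (Fin (K + 1)) (Fin (K + 1)) ℝ) (ν : Fin (K + 1) → PMF ℤ)
    (hPnn : ∀ i j, 0 ≤ P i j) (hProw : ∀ i, ∑ j, P i j = 1)
    -- `(X, Y)` is the hidden Markov chain started at `0` (so that conditioning on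
    -- `X₀ = 0` is automatic), with transition matrix `P` and emission distributions `ν`:
    (hpathXY : ∀ (m : ℕ) (x : ℕ → Fin (K + 1)) (y : ℕ → ℤ),
      (Pr (⋂ i ∈ Finset.range (m + 1), {ω | X i ω = x i ∧ Y i ω = y i})).toReal
        = (if x 0 = 0 then (1 : ℝ) else 0)
          * (∏ i ∈ Finset.range m, P (x i) (x (i + 1)))
          * ∏ i ∈ Finset.range (m + 1), ((ν (x i)) (y i)).toReal)
    -- the chain is irreducible and aperiodic:
    (hirr : ∀ i j : Fin (K + 1), ∃ m : ℕ, 0 < m ∧ 0 < (P ^ m) i j)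
    (haper : ∀ d : ℕ, (∀ m : ℕ, 0 < m → 0 < (P ^ m) 0 0 → d ∣ m) → d = 1)
    -- `Q` is concentrated on `dℤ`, `d ≥ 2`:
    (d : ℕ) (hd : 2 ≤ d)
    (hQd : Pr {ω | ¬ (d : ℤ) ∣ ∑ j ∈ Finset.Icc 1 (sInf {m | 1 ≤ m ∧ X m ω = 0}), Y j ω}
      = 0) :
    ∃ r ρ : Fin (K + 1) → ZMod d,
      r 0 = 0 ∧
      -- (i) `L(Y₁ | X₁ = k)` is concentrated on `dℤ + ρ(k)`:
      (∀ (k : Fin (K + 1)) (y : ℤ), (ν k) y ≠ 0 → (y : ZMod d) = ρ k) ∧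
      -- (ii) conditional on `X₀ = 0` and `X_i = k`, `Σ_{l=1}^i Y_l ≡ r(k) (mod d)` a.s.:
      (∀ (i : ℕ) (k : Fin (K + 1)), 1 ≤ i →
        Pr ({ω | X i ω = k}
          ∩ {ω | ((∑ l ∈ Finset.Icc 1 i, Y l ω : ℤ) : ZMod d) ≠ r k}) = 0) ∧
      -- (iii) `r(k) + ρ(j) ≡ r(j) (mod d)` whenever `p_{kj} > 0`:
      (∀ k j : Fin (K + 1), 0 < P k j → r k + ρ j = r j) := by
  have hexc : ∀ m x z t, IsExcursion P ν 0 m x z t 0 → (d : ℤ) ∣ t := by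
    intro m x z t h
    by_contra hdt
    have hpos := hpathXY m x z
    rw [measure_mono_null _ hQd, ENNReal.toReal_zero, if_pos h.start, one_mul] at hpos
    · refine mul_ne_zero (Finset.prod_ne_zero_iff.mpr fun i hi => ?_)
        (Finset.prod_ne_zero_iff.mpr fun i hi => ?_) hpos.symm
      · exact (h.step i (Finset.mem_range.mp hi)).ne'
      · exact ENNReal.toReal_ne_zero.mpr
          ⟨h.emit i (Nat.lt_succ_iff.mp (Finset.mem_range.mp hi)), PMF.apply_ne_top _ _⟩
    · intro ω hω
      simp only [Set.mem_iInter, Finset.mem_range, Set.mem_ofPred_eq] at hω ⊢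
      have hm : m ∈ {m | 1 ≤ m ∧ X m ω = 0} :=
        ⟨h.pos, by rw [(hω m (by omega)).1, h.finish]⟩
      have hS : sInf {m | 1 ≤ m ∧ X m ω = 0} = m := by
        refine (Nat.sInf_le hm).antisymm (not_lt.mp fun hlt => ?_)
        obtain ⟨h1, h2⟩ := Nat.sInf_mem ⟨m, hm⟩
        exact h.avoid _ h1 hlt ((hω _ (by omega)).1.symm.trans h2)
      rw [hS, Finset.sum_congr rfl fun i hi =>
        (hω i (Nat.lt_succ_iff.mpr (Finset.mem_Icc.mp hi).2)).2, h.sum_eq]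
      exact hdt
  have hconn : ∀ i j, ∃ s, HiddenWalk P ν i s j := fun i j => by
    obtain ⟨m, hm, h⟩ := hirr i j
    obtain ⟨n, rfl⟩ := Nat.exists_eq_succ_of_ne_zero hm.ne'
    exact HiddenWalk.exists_of_pow_ne_zero hPnn h.ne'
  have hclosed : ∀ s, HiddenWalk P ν 0 s 0 → (d : ℤ) ∣ s := fun s h => h.dvd_of_closed hexc
  obtain ⟨r, hr⟩ := exists_residue_of_closed_walks hconn hclosed
  have hstep : ∀ {k j y}, 0 < P k j → ν j y ≠ 0 → r k + (y : ZMod d) = r j := by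
    intro k j y hkj hy
    obtain ⟨s, hs⟩ := hconn 0 k
    rw [← hr s k hs, ← hr _ j (hs.tail hkj hy), Int.cast_add]
  choose p hp using fun k => (hconn 0 k).choose_spec.exists_pred
  have hρ : ∀ (k : Fin (K + 1)) (y : ℤ), ν k y ≠ 0 → (y : ZMod d) = r k - r (p k) :=
    fun k y hy => eq_sub_of_add_eq' (hstep (hp k) hy)
  refine ⟨r, fun k => r k - r (p k), ?_, hρ, ?_, ?_⟩
  · obtain ⟨s, hs⟩ := hconn 0 0
    rw [← hr s 0 hs]
    exact (ZMod.intCast_zmod_eq_zero_iff_dvd _ d).mpr (hclosed s hs)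
  · intro i k hi
    obtain ⟨n, rfl⟩ := Nat.exists_eq_succ_of_ne_zero (Nat.one_le_iff_ne_zero.mp hi)
    refine measure_mono_null ?_
      (ae_iff.mp (ae_path_prob_ne_zero (μ := Pr) (fun i ω => (X i ω, Y i ω)) (n + 1)))
    rintro ω ⟨rfl, hω⟩ hne
    refine hω (hr _ _ ?_)
    have hprob := hpathXY (n + 1) (X · ω) (Y · ω)
    simp only [Prod.mk.injEq] at hne
    have hne' := hprob ▸ ENNReal.toReal_ne_zero.mpr ⟨hne, measure_ne_top _ _⟩
    obtain ⟨h, hemit⟩ := mul_ne_zero_iff.mp hne'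
    obtain ⟨hstart, htrans⟩ := mul_ne_zero_iff.mp h
    have h0 : X 0 ω = 0 := by
      by_contra h0
      exact hstart (if_neg h0)
    have hwalk := HiddenWalk.of_path (P := P) (ν := ν) (x := (X · ω)) (y := (Y · ω)) (n := n)
      (fun i hi => (hPnn _ _).lt_of_ne'
        (Finset.prod_ne_zero_iff.mp htrans i (Finset.mem_range.mpr (by omega))))
      (fun i hi => (ENNReal.toReal_ne_zero.mp
        (Finset.prod_ne_zero_iff.mp hemit i (Finset.mem_range.mpr (by omega)))).1)
    simpa only [h0] using hwalk
  · intro k j hkj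
    obtain ⟨y, hy⟩ := (ν j).support_nonempty
    rw [PMF.mem_support_iff] at hy
    simpa only [hρ j y hy] using hstep hkj hy
end
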